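/- arXiv:0911.5647 — 2 statements merged into one kernel-verified Lean document; each statement's English description precedes it below -/
import Mathlib

section
/- Let (ζ_n)_{n≥1} be any sequence of random variables on a common probability space such that for each n, ζ_n has the Binomial(n, 1/n) distribution (no independence assumed). Then ζ_n / log n → 0 almost surely as n → ∞. -/
open MeasureTheory ProbabilityTheory Filter
open scoped ENNReal

/-- The probability generating function of the Binomial(n, 1/n) distribution is at most `exp a`
at `a ≥ 0`. -/
theorem sum_pow_mul_binomial_le_exp {n : ℕ} (hn : 1 ≤ n) {a : ℝ} (ha : 0 ≤ a) :
    ∑ k ∈ Finset.range (n + 1),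
      a ^ k * ((n.choose k : ℝ) * (1 / n) ^ k * (1 - 1 / n) ^ (n - k)) ≤ Real.exp a := by
  have hn0 : (1 : ℝ) ≤ n := by exact_mod_cast hn
  have hle : (1 : ℝ) / n ≤ 1 := by rw [div_le_one (by linarith)]; exact hn0
  have hsum : ∑ k ∈ Finset.range (n + 1),
      a ^ k * ((n.choose k : ℝ) * (1 / n) ^ k * (1 - 1 / n) ^ (n - k))
      = (a * (1 / n) + (1 - 1 / n)) ^ n := by
    rw [add_pow]
    refine Finset.sum_congr rfl fun k _ => ?_
    rw [mul_pow]
    ring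
  have hbase : a * (1 / n) + (1 - 1 / n) ≤ Real.exp (a / n) := by
    have h1 := Real.add_one_le_exp (a / n)
    have h2 : (0 : ℝ) ≤ 1 / n := by positivity
    have h3 : a * (1 / n) = a / n := by ring
    linarith
  have hnonneg : 0 ≤ a * (1 / n) + (1 - 1 / (n : ℝ)) :=
    add_nonneg (by positivity) (by linarith)
  calc _ = (a * (1 / n) + (1 - 1 / n)) ^ n := hsum
    _ ≤ Real.exp (a / n) ^ n := pow_le_pow_left₀ hnonneg hbase n
    _ = Real.exp a := by
      rw [← Real.exp_nat_mul]
      congr 1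
      field_simp

theorem lintegral_pow_le_of_binomial {Ω : Type*} [MeasurableSpace Ω] {P : Measure Ω}
    {X : Ω → ℕ} (hX : Measurable X) {n : ℕ} (hn : 1 ≤ n)
    (hbin : ∀ k : ℕ, P {ω | X ω = k} =
      ENNReal.ofReal ((n.choose k : ℝ) * (1 / n) ^ k * (1 - 1 / n) ^ (n - k)))
    {a : ℝ} (ha : 0 ≤ a) :
    ∫⁻ ω, ENNReal.ofReal (a ^ X ω) ∂P ≤ ENNReal.ofReal (Real.exp a) := by
  have hn0 : (1 : ℝ) ≤ n := by exact_mod_cast hn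
  have hle : 0 ≤ 1 - (1 : ℝ) / n := by
    rw [sub_nonneg, div_le_one (by linarith)]; exact hn0
  have hmap : ∫⁻ ω, ENNReal.ofReal (a ^ X ω) ∂P
      = ∫⁻ k, ENNReal.ofReal (a ^ k) ∂(P.map X) :=
    (lintegral_map (f := fun k : ℕ => ENNReal.ofReal (a ^ k)) (measurable_of_countable _) hX).symm
  have hterm : ∀ k : ℕ, ENNReal.ofReal (a ^ k) * P.map X {k} = ENNReal.ofReal
      (a ^ k * ((n.choose k : ℝ) * (1 / n) ^ k * (1 - 1 / n) ^ (n - k))) := fun k => by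
    rw [Measure.map_apply hX (measurableSet_singleton k), ENNReal.ofReal_mul (by positivity),
      ← hbin k]
    rfl
  rw [hmap, lintegral_countable', tsum_congr hterm,
    tsum_eq_sum (s := Finset.range (n + 1)), ← ENNReal.ofReal_sum_of_nonneg]
  · exact ENNReal.ofReal_le_ofReal (sum_pow_mul_binomial_le_exp hn ha)
  · intro k _
    positivity
  · intro k hk
    rw [Nat.choose_eq_zero_of_lt (by simpa using hk)]
    simp

/-- A sequence of natural-valued random variables with uniformly bounded `E[a ^ X_n]` satisfies
`a ^ X_n ≤ n ^ 2` eventually, almost surely. -/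
theorem ae_eventually_pow_le_sq {Ω : Type*} [MeasurableSpace Ω] {P : Measure Ω}
    {X : ℕ → Ω → ℕ} (hX : ∀ n, Measurable (X n)) {a : ℝ} {C : ℝ}
    (hC : ∀ n, 1 ≤ n → ∫⁻ ω, ENNReal.ofReal (a ^ X n ω) ∂P ≤ ENNReal.ofReal C) :
    ∀ᵐ ω ∂P, ∀ᶠ n : ℕ in atTop, a ^ X n ω ≤ (n : ℝ) ^ 2 := by
  have hmeas : ∀ n, Measurable fun ω => ENNReal.ofReal (a ^ X (n + 1) ω) := fun n =>
    (measurable_of_countable fun k : ℕ => ENNReal.ofReal (a ^ k)).comp (hX (n + 1))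
  have hmarkov : ∀ n : ℕ, P {ω | ((n + 1 : ℕ) : ℝ) ^ 2 < a ^ X (n + 1) ω}
      ≤ ENNReal.ofReal (C * (1 / ((n + 1 : ℕ) : ℝ) ^ 2)) := fun n => by
    have hpos : (0 : ℝ) < ((n + 1 : ℕ) : ℝ) ^ 2 := by positivity
    calc P {ω | ((n + 1 : ℕ) : ℝ) ^ 2 < a ^ X (n + 1) ω}
        ≤ P {ω | ENNReal.ofReal (((n + 1 : ℕ) : ℝ) ^ 2) ≤ ENNReal.ofReal (a ^ X (n + 1) ω)} :=
          measure_mono fun ω hω => ENNReal.ofReal_le_ofReal (le_of_lt hω)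
      _ ≤ (∫⁻ ω, ENNReal.ofReal (a ^ X (n + 1) ω) ∂P) / ENNReal.ofReal (((n + 1 : ℕ) : ℝ) ^ 2) :=
          meas_ge_le_lintegral_div (hmeas n).aemeasurable
            (ENNReal.ofReal_pos.2 hpos).ne' ENNReal.ofReal_ne_top
      _ ≤ ENNReal.ofReal C / ENNReal.ofReal (((n + 1 : ℕ) : ℝ) ^ 2) :=
          ENNReal.div_le_div_right (hC _ (Nat.le_add_left 1 n)) _
      _ = ENNReal.ofReal (C * (1 / ((n + 1 : ℕ) : ℝ) ^ 2)) := by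
          rw [← ENNReal.ofReal_div_of_pos hpos, mul_one_div]
  have hsummable : Summable fun n : ℕ => C * (1 / ((n + 1 : ℕ) : ℝ) ^ 2) :=
    ((summable_nat_add_iff 1).2 (Real.summable_one_div_nat_pow.2 one_lt_two)).mul_left C
  have hfin : ∑' n : ℕ, P {ω | ((n + 1 : ℕ) : ℝ) ^ 2 < a ^ X (n + 1) ω} ≠ ∞ :=
    ne_top_of_le_ne_top hsummable.tsum_ofReal_ne_top (ENNReal.tsum_le_tsum hmarkov)
  filter_upwards [ae_eventually_notMem hfin] with ω hω
  rw [← map_add_atTop_eq_nat 1, eventually_map]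
  filter_upwards [hω] with n hn
  exact not_lt.1 hn

/-- If for each `n ≥ 1`, `ζ_n` has the Binomial(n, 1/n) distribution (no independence
assumed), then `ζ_n / log n → 0` almost surely. -/
theorem binomial_div_log_tendsto_zero
    {Ω : Type*} [MeasurableSpace Ω] (P : Measure Ω) [IsProbabilityMeasure P]
    (ζ : ℕ → Ω → ℕ) (hmeas : ∀ n, Measurable (ζ n))
    (hbin : ∀ n : ℕ, 1 ≤ n → ∀ k : ℕ, P {ω | ζ n ω = k} =
      ENNReal.ofReal ((n.choose k : ℝ) * (1 / n) ^ k * (1 - 1 / n) ^ (n - k))) :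
    ∀ᵐ ω ∂P, Tendsto (fun n : ℕ => (ζ n ω : ℝ) / Real.log n) atTop (nhds 0) := by
  have hae : ∀ᵐ ω ∂P, ∀ m : ℕ, ∀ᶠ n : ℕ in atTop, Real.exp m ^ ζ n ω ≤ (n : ℝ) ^ 2 :=
    ae_all_iff.2 fun m => ae_eventually_pow_le_sq hmeas fun n hn =>
      lintegral_pow_le_of_binomial (hmeas n) hn (hbin n hn) (Real.exp_pos m).le
  filter_upwards [hae] with ω hω
  rw [Metric.tendsto_nhds]
  intro ε hε
  obtain ⟨m, hm⟩ := exists_nat_gt (2 / ε)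
  filter_upwards [hω m, eventually_ge_atTop 2] with n hn hn2
  have hlog : 0 < Real.log n := Real.log_pos (by exact_mod_cast hn2)
  have hm0 : (0 : ℝ) < m := (div_pos two_pos hε).trans hm
  have hbound : (ζ n ω : ℝ) * m ≤ 2 * Real.log n := by
    have h := Real.log_le_log (by positivity) hn
    simpa [Real.log_pow] using h
  rw [Real.dist_eq, sub_zero, abs_of_nonneg (by positivity), div_lt_iff₀ hlog]
  rw [div_lt_iff₀ hε] at hm
  refine lt_of_mul_lt_mul_right (hbound.trans_lt ?_) hm0.le
  nlinarith
end

section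
/- Let n ≥ 2 and let w be a nonnegative function on the set of partitions of {1,…,n}. Then w is exchangeable if and only if w is both partially exchangeable and restricted exchangeable with respect to the decomposition into {π : 1 and 2 lie in different blocks of π} and {π : 1 and 2 lie in the same block of π}. -/
open Classical

/-- The block of the partition (equivalence relation) `s` containing `i`. -/
noncomputable def blockOf {n : ℕ} (s : Setoid (Fin n)) (i : Fin n) : Finset (Fin n) :=
  Finset.univ.filter (fun j => s.r i j)

/-- The multiset of block sizes of the partition `s`. -/
noncomputable def sizeMultiset {n : ℕ} (s : Setoid (Fin n)) : Multiset ℕ :=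
  (Finset.univ.image (fun i => blockOf s i)).val.map Finset.card

/-- The vector (list) of block sizes of `s`, with blocks in order of least element:
scanning the elements in increasing order, we record the size of a block exactly when
we meet its least element. -/
noncomputable def orderedSizes {n : ℕ} (s : Setoid (Fin n)) : List ℕ :=
  (List.finRange n).filterMap (fun i =>
    if ∀ j, s.r i j → i ≤ j then some (blockOf s i).card else none)

/-- `i` is the least element of its block in `s`. -/
def IsLeader {n : ℕ} (s : Setoid (Fin n)) (i : Fin n) : Prop :=
  ∀ j, s.r i j → i ≤ j

/-- The least elements of the blocks of `s`, in increasing order. -/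
noncomputable def leaders {n : ℕ} (s : Setoid (Fin n)) : List (Fin n) :=
  (List.finRange n).filter (fun i => decide (IsLeader s i))

section

variable {n : ℕ} {s t : Setoid (Fin n)}

theorem mem_leaders {i : Fin n} : i ∈ leaders s ↔ IsLeader s i := by
  simp [leaders]

theorem pairwise_lt_leaders (s : Setoid (Fin n)) : (leaders s).Pairwise (· < ·) :=
  (List.pairwise_lt_finRange n).filter _

theorem orderedSizes_eq_map_leaders (s : Setoid (Fin n)) :
    orderedSizes s = (leaders s).map (fun i => (blockOf s i).card) := by
  unfold orderedSizes leaders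
  induction List.finRange n with
  | nil => rfl
  | cons a l ih =>
    rw [List.filterMap_cons, List.filter_cons, ih]
    by_cases h : IsLeader s a
    · rw [if_pos (show ∀ j, s.r a j → a ≤ j from h), if_pos (decide_eq_true h), List.map_cons]
    · rw [if_neg (show ¬ ∀ j, s.r a j → a ≤ j from h), if_neg (by rwa [decide_eq_true_iff])]

theorem mem_blockOf {i j : Fin n} : j ∈ blockOf s i ↔ s.r i j := by
  simp [blockOf]

theorem blockOf_eq_iff {i j : Fin n} : blockOf s i = blockOf s j ↔ s.r i j := by
  constructor
  · intro h
    rw [← mem_blockOf, h, mem_blockOf]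
  · intro h
    ext k
    simp only [mem_blockOf]
    exact ⟨fun hk => s.trans (s.symm h) hk, fun hk => s.trans h hk⟩

theorem exists_isLeader (s : Setoid (Fin n)) (i : Fin n) : ∃ l, IsLeader s l ∧ s.r i l := by
  have hne : (blockOf s i).Nonempty := ⟨i, mem_blockOf.2 (s.refl i)⟩
  have hmem := mem_blockOf.1 ((blockOf s i).min'_mem hne)
  exact ⟨_, fun j hj => Finset.min'_le _ _ (mem_blockOf.2 (s.trans hmem hj)), hmem⟩

theorem IsLeader.eq_of_rel {i j : Fin n} (hi : IsLeader s i) (hj : IsLeader s j)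
    (h : s.r i j) : i = j :=
  le_antisymm (hi j h) (hj i (s.symm h))

theorem sizeMultiset_eq_coe_orderedSizes (s : Setoid (Fin n)) :
    sizeMultiset s = (orderedSizes s : Multiset ℕ) := by
  have himage : Finset.univ.image (blockOf s) = (leaders s).toFinset.image (blockOf s) := by
    ext B
    simp only [Finset.mem_image, Finset.mem_univ, true_and, List.mem_toFinset, mem_leaders]
    constructor
    · rintro ⟨i, rfl⟩
      obtain ⟨l, hl, hil⟩ := exists_isLeader s i
      exact ⟨l, hl, (blockOf_eq_iff.2 hil).symm⟩
    · rintro ⟨i, -, rfl⟩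
      exact ⟨i, rfl⟩
  have hinj : Set.InjOn (blockOf s) (leaders s).toFinset := by
    intro i hi j hj h
    simp only [List.coe_toFinset, Set.mem_ofPred_eq, mem_leaders] at hi hj
    exact hi.eq_of_rel hj (blockOf_eq_iff.1 h)
  have hnodup : (leaders s).Nodup := (List.nodup_finRange n).filter _
  change (Finset.univ.image (blockOf s)).val.map Finset.card = _
  rw [himage, Finset.image_val_of_injOn hinj, List.toFinset_val, hnodup.dedup,
    orderedSizes_eq_map_leaders]
  simp [Function.comp_def]

/-- A relabelling that maps block minima to block minima and preserves their order preserves the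
vector of block sizes. -/
theorem orderedSizes_eq_of_strictMonoOn (σ : Equiv.Perm (Fin n))
    (hσ : ∀ i j, t.r (σ i) (σ j) ↔ s.r i j)
    (hleader : ∀ i, IsLeader s i → IsLeader t (σ i))
    (hmono : StrictMonoOn σ {i | IsLeader s i}) : orderedSizes t = orderedSizes s := by
  have hcard : ∀ i, (blockOf t (σ i)).card = (blockOf s i).card := by
    intro i
    symm
    refine Finset.card_equiv σ fun j => ?_
    rw [mem_blockOf, mem_blockOf, hσ]
  have hleaders : leaders t = (leaders s).map σ := by
    have hpair : ((leaders s).map σ).Pairwise (· < ·) := by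
      rw [List.pairwise_map]
      exact (pairwise_lt_leaders s).imp_of_mem fun hi hj h =>
        hmono (mem_leaders.1 hi) (mem_leaders.1 hj) h
    refine (pairwise_lt_leaders t).sortedLT.eq_of_mem_iff hpair.sortedLT fun j => ?_
    simp only [List.mem_map, mem_leaders]
    constructor
    · intro hj
      obtain ⟨l, hl, hjl⟩ := exists_isLeader s (σ.symm j)
      refine ⟨l, hl, (hleader l hl).eq_of_rel hj (t.symm ?_)⟩
      simpa using (hσ _ _).2 hjl
    · rintro ⟨i, hi, rfl⟩
      exact hleader i hi
  simp [orderedSizes_eq_map_leaders, hleaders, hcard]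

/-- If `s` relates the two smallest elements and has a further block, then swapping the second
smallest element with the least element of the second block separates the two smallest elements
and preserves the vector of block sizes. -/
theorem exists_orderedSizes_eq_not_rel (z o : Fin n) (hz : z.val = 0) (ho : o.val = 1)
    (hzo : s.r z o) (hne : ∃ b, ¬ s.r z b) :
    ∃ t : Setoid (Fin n), orderedSizes t = orderedSizes s ∧ ¬ t.r z o := by
  obtain ⟨b, hb, hbmin⟩ : ∃ b, ¬ s.r z b ∧ ∀ c, ¬ s.r z c → b ≤ c := by
    obtain ⟨b, hb⟩ := WellFounded.has_min wellFounded_lt {b | ¬ s.r z b} hne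
    exact ⟨b, hb.1, fun c hc => not_lt.1 (hb.2 c hc)⟩
  have hbz : b ≠ z := fun h => hb (h ▸ s.refl z)
  have hbo : b ≠ o := fun h => hb (h ▸ hzo)
  have hzlt : z < o := by rw [Fin.lt_def]; omega
  have hob : o < b := by
    have h₀ := Fin.val_ne_of_ne hbz
    have h₁ := Fin.val_ne_of_ne hbo
    rw [Fin.lt_def]; omega
  have hzle : ∀ i, z ≤ i := fun i => by rw [Fin.le_def]; omega
  have hole : ∀ i, i ≠ z → o ≤ i := fun i hi => by
    have := Fin.val_ne_of_ne hi
    rw [Fin.le_def]; omega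
  set σ := Equiv.swap o b with hσ
  have hσz : σ z = z := Equiv.swap_apply_of_ne_of_ne hzlt.ne hbz.symm
  have hσb : σ b = o := Equiv.swap_apply_right o b
  have hσgt : ∀ i, b < i → σ i = i := fun i hi =>
    Equiv.swap_apply_of_ne_of_ne (hob.trans hi).ne' hi.ne'
  have hcases : ∀ i, IsLeader s i → i = z ∨ i = b ∨ b < i := by
    intro i hi
    by_cases h : s.r z i
    · exact .inl (le_antisymm (hi z (s.symm h)) (hzle i))
    · exact .inr ((hbmin i h).eq_or_lt.imp Eq.symm id)
  have hne_z : ∀ i, i ≠ z → σ i ≠ z := fun i hi h => hi (σ.injective (h.trans hσz.symm))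
  refine ⟨s.comap σ, orderedSizes_eq_of_strictMonoOn σ ?_ ?_ ?_, ?_⟩
  · intro i j
    change s.r (σ (σ i)) (σ (σ j)) ↔ _
    simp [hσ]
  · intro i hi k hk
    obtain ⟨m, rfl⟩ := σ.surjective k
    replace hk : s.r i m := by
      change s.r (σ (σ i)) (σ (σ m)) at hk
      simpa [hσ] using hk
    rcases hcases i hi with rfl | rfl | h
    · rw [hσz]; exact hzle _
    · rw [hσb]
      exact hole _ (hne_z m fun h => hb (s.symm (h ▸ hk)))
    · rw [hσgt i h, hσgt m (h.trans_le (hi m hk))]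
      exact hi m hk
  · intro i hi j hj hij
    rcases hcases i hi with rfl | rfl | h
    · rw [hσz]
      exact lt_of_le_of_ne (hzle _) (hne_z j hij.ne').symm
    · rw [hσb, hσgt j hij]
      exact hob.trans hij
    · rw [hσgt i h, hσgt j (h.trans hij)]
      exact hij
  · change ¬ s.r (σ z) (σ o)
    rwa [hσz, hσ, Equiv.swap_apply_left]

theorem exists_not_rel_of_sizeMultiset_eq (h : sizeMultiset s = sizeMultiset t) {i j : Fin n}
    (hij : ¬ t.r i j) : ∃ b, ¬ s.r i b := by
  by_contra! hall
  have hcard := congrArg Multiset.card h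
  simp only [sizeMultiset, Multiset.card_map, Finset.card_val] at hcard
  have hs : (Finset.univ.image (fun k => blockOf s k)).card ≤ 1 := by
    rw [Finset.card_le_one]
    simp only [Finset.mem_image, Finset.mem_univ, true_and]
    rintro _ ⟨a, rfl⟩ _ ⟨b, rfl⟩
    exact blockOf_eq_iff.2 (s.trans (s.symm (hall a)) (hall b))
  rw [hcard, Finset.card_le_one] at hs
  exact hij (blockOf_eq_iff.1 (hs _ (Finset.mem_image_of_mem _ (Finset.mem_univ i)) _
    (Finset.mem_image_of_mem _ (Finset.mem_univ j))))

end

/-- A nonnegative function `w` on partitions of `{1,…,n}` (`n ≥ 2`) is exchangeable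
(constant on partitions with the same multiset of block sizes) if and only if it is
both partially exchangeable (constant on partitions with the same vector of block
sizes in order of least element) and restricted exchangeable with respect to the
decomposition `𝒫¹ = {π : 1, 2 in different blocks}`, `𝒫² = {π : 1, 2 in the same
block}` (constant on partitions with the same multiset of block sizes lying in the
same part of the decomposition). -/
theorem exchangeable_iff_partially_and_restricted
    {n : ℕ} (hn : 2 ≤ n) (w : Setoid (Fin n) → ℝ) (hw : ∀ s, 0 ≤ w s) :
    (∀ s s' : Setoid (Fin n), sizeMultiset s = sizeMultiset s' → w s = w s') ↔
      ((∀ s s' : Setoid (Fin n), orderedSizes s = orderedSizes s' → w s = w s') ∧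
        (∀ s s' : Setoid (Fin n), sizeMultiset s = sizeMultiset s' →
          (s.r ⟨0, by omega⟩ ⟨1, by omega⟩ ↔ s'.r ⟨0, by omega⟩ ⟨1, by omega⟩) →
          w s = w s')) := by
  constructor
  · intro h
    refine ⟨fun s s' hs => h s s' ?_, fun s s' hs _ => h s s' hs⟩
    rw [sizeMultiset_eq_coe_orderedSizes, sizeMultiset_eq_coe_orderedSizes, hs]
  · rintro ⟨hpartial, hrestricted⟩
    have key : ∀ s s' : Setoid (Fin n), sizeMultiset s = sizeMultiset s' →
        s.r ⟨0, by omega⟩ ⟨1, by omega⟩ → ¬ s'.r ⟨0, by omega⟩ ⟨1, by omega⟩ → w s = w s' := by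
      intro s s' h hs hs'
      obtain ⟨t, ht, htne⟩ := exists_orderedSizes_eq_not_rel _ _ rfl rfl hs
        (exists_not_rel_of_sizeMultiset_eq h hs')
      rw [← hpartial t s ht]
      refine hrestricted t s' ?_ (iff_of_false htne hs')
      rw [← h, sizeMultiset_eq_coe_orderedSizes, sizeMultiset_eq_coe_orderedSizes, ht]
    intro s s' h
    by_cases hs : s.r ⟨0, by omega⟩ ⟨1, by omega⟩ <;>
      by_cases hs' : s'.r ⟨0, by omega⟩ ⟨1, by omega⟩
    · exact hrestricted s s' h (iff_of_true hs hs')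
    · exact key s s' h hs hs'
    · exact (key s' s h.symm hs' hs).symm
    · exact hrestricted s s' h (iff_of_false hs hs')
end
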